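/- arXiv:2207.07393 — 2 statements merged into one kernel-verified Lean document; each statement's English description precedes it below -/
import Mathlib

section
/- Let p₂ > 3 be a prime with p₂ ≡ 1 (mod 3), set q₂ = (p₂ − 1)/3 (which is even), and let p₃ be a prime with p₃ > 3p₂ and p₃ ≡ 2 (mod 3p₂); set q₃ = (p₃ − 2)/(3p₂). Let i = 3u with 0 ≤ u ≤ q₂ (so i ≤ p₂ − 1). Then hw(f_{3p₂,p₃,i,q₃}) = 2 if 0 ≤ u ≤ q₂/2 − 1, and hw(f_{3p₂,p₃,i,q₃}) = 1 if q₂/2 ≤ u ≤ q₂. -/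
open Polynomial

/-- The Hamming weight of a polynomial: its number of nonzero coefficients. -/
noncomputable def hw (f : Polynomial ℤ) : ℕ := f.support.card

/-- The last block `f_{3p₂,p₃,i,q₃}`: the polynomial of degree `< 2` whose coefficient of
`x^k` is the coefficient of `x^(i*p₃ + 3*p₂*q₃ + k)` in `Φ_{3p₂p₃}`, for `k = 0, 1`. -/
noncomputable def blockQ (p₂ p₃ i q₃ : ℕ) : Polynomial ℤ :=
  ∑ k ∈ Finset.range 2,
    C ((cyclotomic (3 * p₂ * p₃) ℤ).coeff (i * p₃ + 3 * p₂ * q₃ + k)) * X ^ k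

def psi (p n : ℕ) : ℤ := if n < 3 then 1 else if p ≤ n ∧ n < p + 3 then -1 else 0

lemma F_mul (p : ℕ) (hp : p.Prime) (h3 : 3 < p) :
    cyclotomic (3 * p) ℤ * (1 + X + X ^ 2) = 1 + X ^ p + X ^ (2 * p) := by
  have hnd : ¬ p ∣ 3 := fun h => by have := Nat.le_of_dvd (by norm_num) h; omega
  have h := cyclotomic_expand_eq_cyclotomic_mul hp hnd ℤ
  rw [cyclotomic_three] at h
  simp only [map_add, map_pow, expand_X, map_one] at h
  rw [show (1 + X + X ^ 2 : ℤ[X]) = X ^ 2 + X + 1 by ring, ← h, ← pow_mul, mul_comm p 2]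
  ring

lemma a_rec (p : ℕ) (hp : p.Prime) (h3 : 3 < p) (n : ℕ) (hn : n + 2 < p) :
    (cyclotomic (3 * p) ℤ).coeff (n + 2) + (cyclotomic (3 * p) ℤ).coeff (n + 1)
      + (cyclotomic (3 * p) ℤ).coeff n = 0 := by
  have h := congrArg (fun q => coeff q (n + 2)) (F_mul p hp h3)
  simp only [mul_add, mul_one, coeff_add, coeff_mul_X_pow, coeff_X_pow, coeff_one] at h
  rw [show n + 2 = (n + 1) + 1 from rfl, coeff_mul_X] at h
  rw [if_neg (by omega), if_neg (by omega), if_neg (by omega)] at h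
  simpa using h

lemma a_zero (p : ℕ) (hp : p.Prime) : (cyclotomic (3 * p) ℤ).coeff 0 = 1 :=
  cyclotomic_coeff_zero _ (by have := hp.two_le; omega)

lemma a_one (p : ℕ) (hp : p.Prime) (h3 : 3 < p) : (cyclotomic (3 * p) ℤ).coeff 1 = -1 := by
  have h := congrArg (fun q => coeff q 1) (F_mul p hp h3)
  simp only [mul_add, mul_one, coeff_add, coeff_X_pow, coeff_one] at h
  rw [show (1 : ℕ) = 0 + 1 from rfl, coeff_mul_X, coeff_mul_X_pow', a_zero p hp] at h
  rw [if_neg (by omega), if_neg (by omega), if_neg (by omega), if_neg (by omega)] at h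
  simp at h
  linarith

lemma a_val (p : ℕ) (hp : p.Prime) (h3 : 3 < p) (v : ℕ) :
    (3 * v < p → (cyclotomic (3 * p) ℤ).coeff (3 * v) = 1) ∧
    (3 * v + 1 < p → (cyclotomic (3 * p) ℤ).coeff (3 * v + 1) = -1) ∧
    (3 * v + 2 < p → (cyclotomic (3 * p) ℤ).coeff (3 * v + 2) = 0) := by
  induction v with
  | zero =>
    have h := a_rec p hp h3 0 (by omega)
    have h0 := a_zero p hp
    have h1 := a_one p hp h3
    refine ⟨fun _ => h0, fun _ => h1, fun _ => ?_⟩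
    simp only [zero_add, mul_zero] at *
    linarith
  | succ v ih =>
    obtain ⟨ia, ib, ic⟩ := ih
    have e0 : 3 * (v + 1) < p → (cyclotomic (3 * p) ℤ).coeff (3 * (v + 1)) = 1 := fun h => by
      have := a_rec p hp h3 (3 * v + 1) (by omega)
      rw [show 3 * (v + 1) = 3 * v + 1 + 2 by ring]
      have := ib (by omega)
      have := ic (by omega)
      simp only [add_assoc, Nat.reduceAdd] at *
      linarith
    have e1 : 3 * (v + 1) + 1 < p → (cyclotomic (3 * p) ℤ).coeff (3 * (v + 1) + 1) = -1 :=
        fun h => by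
      have h1 := a_rec p hp h3 (3 * v + 2) (by omega)
      have h2 := e0 (by omega)
      have h3 := ic (by omega)
      rw [show 3 * v + 2 + 2 = 3 * (v + 1) + 1 by ring,
        show 3 * v + 2 + 1 = 3 * (v + 1) by ring] at h1
      linarith
    refine ⟨e0, e1, fun h => ?_⟩
    have h1 := a_rec p hp h3 (3 * (v + 1)) (by omega)
    have h2 := e0 (by omega)
    have h3 := e1 (by omega)
    linarith

lemma psi_series (p : ℕ) (h3 : 3 < p) :
    (PowerSeries.mk fun n => psi p (n % (3 * p))) * (1 - PowerSeries.X ^ (3 * p)) =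
      (((1 + X + X ^ 2) * (1 - X ^ p) : ℤ[X]) : PowerSeries ℤ) := by
  ext n
  rw [mul_sub, mul_one, map_sub, PowerSeries.coeff_mul_X_pow', PowerSeries.coeff_mk,
    Polynomial.coeff_coe]
  have hQ : ((1 + X + X ^ 2) * (1 - X ^ p) : ℤ[X]) =
    1 + X ^ 1 + X ^ 2 - X ^ p - X ^ (p + 1) - X ^ (p + 2) := by ring
  rw [hQ]
  simp only [coeff_sub, coeff_add, coeff_X_pow, coeff_one, PowerSeries.coeff_mk]
  by_cases hn : 3 * p ≤ n
  · rw [if_pos hn, ← Nat.mod_eq_sub_mod hn, sub_self]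
    repeat rw [if_neg (by omega)]
    simp
  · rw [if_neg hn, Nat.mod_eq_of_lt (by omega)]
    unfold psi
    split_ifs <;> omega

lemma G_series (p₂ p₃ : ℕ) (hp₂ : p₂.Prime) (h3 : 3 < p₂) (hp₃ : p₃.Prime)
    (hgt : 3 * p₂ < p₃) :
    ((cyclotomic (3 * p₂ * p₃) ℤ : ℤ[X]) : PowerSeries ℤ) =
      ((expand ℤ p₃ (cyclotomic (3 * p₂) ℤ) : ℤ[X]) : PowerSeries ℤ) *
        (PowerSeries.mk fun n => psi p₂ (n % (3 * p₂))) := by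
  have hnd : ¬ p₃ ∣ 3 * p₂ := fun h => by have := Nat.le_of_dvd (by omega) h; omega
  have h := cyclotomic_expand_eq_cyclotomic_mul hp₃ hnd ℤ
  have hne : (1 - PowerSeries.X ^ (3 * p₂) : PowerSeries ℤ) ≠ 0 := by
    intro h0
    have := congrArg (PowerSeries.coeff 0) h0
    rw [map_sub, PowerSeries.coeff_X_pow, if_neg (by omega)] at this
    simp at this
  apply mul_right_cancel₀ hne
  rw [mul_assoc (Polynomial.toPowerSeries _), psi_series p₂ h3, h, ← Polynomial.coe_mul]
  have : (1 - PowerSeries.X ^ (3 * p₂) : PowerSeries ℤ) = ((1 - X ^ (3 * p₂) : ℤ[X]) :) := by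
    simp
  rw [this, ← Polynomial.coe_mul]
  congr 1
  have hF := F_mul p₂ hp₂ h3
  linear_combination (-(cyclotomic (3 * p₂ * p₃) ℤ) * (1 - X ^ p₂)) * hF

lemma G_coeff (p₂ p₃ q₃ : ℕ) (hp₂ : p₂.Prime) (h3 : 3 < p₂) (hp₃ : p₃.Prime)
    (hgt : 3 * p₂ < p₃) (hq₃ : 3 * p₂ * q₃ + 2 = p₃) (i k : ℕ) (hi : i < p₂) (hk : k < 2) :
    (cyclotomic (3 * p₂ * p₃) ℤ).coeff (i * p₃ + 3 * p₂ * q₃ + k) =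
      ∑ d ∈ Finset.range (i + 1), (cyclotomic (3 * p₂) ℤ).coeff (i - d) * psi p₂ (2 * d + k) := by
  rw [← Polynomial.coeff_coe, G_series p₂ p₃ hp₂ h3 hp₃ hgt]
  set F := cyclotomic (3 * p₂) ℤ with hF
  have hE : ((expand ℤ p₃ F : ℤ[X]) : PowerSeries ℤ) =
      ∑ j ∈ Finset.range (F.natDegree + 1 + i),
        PowerSeries.C (F.coeff j) * PowerSeries.X ^ (p₃ * j) := by
    conv_lhs => rw [F.as_sum_range_C_mul_X_pow' (n := F.natDegree + 1 + i) (by omega)]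
    rw [map_sum, ← Polynomial.coeToPowerSeries.ringHom_apply, map_sum]
    refine Finset.sum_congr rfl fun j _ => ?_
    rw [map_mul, map_pow, expand_C, expand_X, ← pow_mul, Polynomial.coeToPowerSeries.ringHom_apply,
      Polynomial.coe_mul, Polynomial.coe_C, Polynomial.coe_pow, Polynomial.coe_X]
  rw [hE, Finset.sum_mul, map_sum]
  have hsub : Finset.range (i + 1) ⊆ Finset.range (F.natDegree + 1 + i) :=
    Finset.range_mono (by omega)
  rw [← Finset.sum_subset hsub]
  · rw [← Finset.sum_range_reflect]
    refine Finset.sum_congr rfl fun d hd => ?_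
    simp only [Finset.mem_range] at hd
    rw [show i + 1 - 1 - d = i - d by omega]
    have hN : i * p₃ + 3 * p₂ * q₃ + k = 2 * d + k + 3 * p₂ * (q₃ + d * q₃) + p₃ * (i - d) := by
      obtain ⟨e, rfl⟩ : ∃ e, i = d + e := ⟨i - d, by omega⟩
      rw [Nat.add_sub_cancel_left, ← hq₃]; ring
    rw [mul_assoc (PowerSeries.C _), PowerSeries.coeff_C_mul, hN, PowerSeries.coeff_X_pow_mul,
      PowerSeries.coeff_mk, Nat.add_mul_mod_self_left, Nat.mod_eq_of_lt (by omega)]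
  · intro j _ hj
    simp only [Finset.mem_range] at hj
    have : p₃ * (i + 1) ≤ p₃ * j := Nat.mul_le_mul_left _ (by omega)
    have h2 : p₃ * (i + 1) = i * p₃ + p₃ := by ring
    rw [mul_assoc (PowerSeries.C _), PowerSeries.coeff_C_mul, PowerSeries.coeff_X_pow_mul', if_neg (by omega),
      mul_zero]

theorem stmt14 (p₂ p₃ q₂ q₃ : ℕ) (hp₂ : p₂.Prime) (h3 : 3 < p₂) (hq₂ : 3 * q₂ + 1 = p₂)
    (hp₃ : p₃.Prime) (hgt : 3 * p₂ < p₃) (hmod : p₃ % (3 * p₂) = 2)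
    (hq₃ : 3 * p₂ * q₃ + 2 = p₃)
    (u i : ℕ) (hiv : i = 3 * u) (hu : u ≤ q₂) :
    (u ≤ q₂ / 2 - 1 → hw (blockQ p₂ p₃ i q₃) = 2) ∧
    (q₂ / 2 ≤ u → hw (blockQ p₂ p₃ i q₃) = 1) := by
  obtain ⟨r, hr⟩ : ∃ r, q₂ = 2 * r := by
    have := hp₂.eq_two_or_odd
    exact ⟨q₂ / 2, by omega⟩
  have hc0 : (cyclotomic (3 * p₂ * p₃) ℤ).coeff (i * p₃ + 3 * p₂ * q₃ + 0) = 1 := by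
    rw [G_coeff p₂ p₃ q₃ hp₂ h3 hp₃ hgt hq₃ i 0 (by omega) (by omega)]
    rw [Finset.sum_eq_single_of_mem 0 (by simp)]
    · simp only [psi]
      rw [hiv, Nat.sub_zero, (a_val p₂ hp₂ h3 u).1 (by omega)]
      simp
    · intro d hd hd0
      simp only [Finset.mem_range] at hd
      by_cases h1 : d = 1
      · rw [show i - d = 3 * (u - 1) + 2 by omega, (a_val p₂ hp₂ h3 _).2.2 (by omega), zero_mul]
      by_cases h2 : d = 3 * r + 1
      · rw [show i - d = 3 * (u - r - 1) + 2 by omega, (a_val p₂ hp₂ h3 _).2.2 (by omega),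
          zero_mul]
      unfold psi
      rw [if_neg (by omega), if_neg (by omega), mul_zero]
  have hc1 : (cyclotomic (3 * p₂ * p₃) ℤ).coeff (i * p₃ + 3 * p₂ * q₃ + 1) =
      if u < r then 1 else 0 := by
    rw [G_coeff p₂ p₃ q₃ hp₂ h3 hp₃ hgt hq₃ i 1 (by omega) (by omega)]
    have key : ∀ d ∈ Finset.range (i + 1),
        (cyclotomic (3 * p₂) ℤ).coeff (i - d) * psi p₂ (2 * d + 1) =
        (if d = 0 then 1 else 0) + (if d = 3 * r then -1 else 0) := by
      intro d hd
      simp only [Finset.mem_range] at hd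
      by_cases h0 : d = 0
      · rw [show i - d = 3 * u by omega, (a_val p₂ hp₂ h3 _).1 (by omega)]
        unfold psi
        rw [if_pos (by omega), if_pos h0, if_neg (by omega)]; norm_num
      rw [if_neg h0]
      by_cases h1 : d = 3 * r
      · rw [show i - d = 3 * (u - r) by omega, (a_val p₂ hp₂ h3 _).1 (by omega)]
        unfold psi
        rw [if_neg (by omega), if_pos (by omega), if_pos h1]; norm_num
      rw [if_neg h1]
      by_cases h2 : d = 3 * r + 1
      · rw [show i - d = 3 * (u - r - 1) + 2 by omega, (a_val p₂ hp₂ h3 _).2.2 (by omega)]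
        norm_num
      unfold psi
      rw [if_neg (by omega), if_neg (by omega)]; norm_num
    rw [Finset.sum_congr rfl key, Finset.sum_add_distrib, Finset.sum_ite_eq', Finset.sum_ite_eq']
    simp only [Finset.mem_range]
    split_ifs <;> omega
  have hb : blockQ p₂ p₃ i q₃ = 1 + C (if u < r then (1 : ℤ) else 0) * X := by
    unfold blockQ
    rw [Finset.sum_range_succ, Finset.sum_range_one, hc0, hc1]
    simp
  rw [hb]
  constructor
  · intro h
    rw [if_pos (by omega)]
    have : (1 + C 1 * X : ℤ[X]) = C 1 * X ^ 0 + C 1 * X ^ 1 := by simp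
    rw [hw, this]
    exact card_support_binomial (by norm_num) one_ne_zero one_ne_zero
  · intro h
    rw [if_neg (by omega)]
    have : (1 + C 0 * X : ℤ[X]) = C 1 * X ^ 0 := by simp
    rw [hw, this, support_C_mul_X_pow _ one_ne_zero]
    simp
end

section
/- Let p₂ > 3 be a prime and let p₃ be a prime with p₃ > 3p₂ and p₃ ≡ 2 (mod 3p₂). Then hw(f_{3p₂,p₃,p₂−1,0}) = 2(p₂ − 1) if p₂ ≡ 1 (mod 3), and hw(f_{3p₂,p₃,p₂−1,0}) = 2p₂ + 1 if p₂ ≡ 2 (mod 3). -/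
open Polynomial

/-- The block `f_{m,p,i,0}`: the polynomial of degree `< m` whose coefficient of `x^k`
is the coefficient of `x^(i*p + k)` in `Φ_{mp}`, for `0 ≤ k < m`. -/
noncomputable def blockPoly (m p i : ℕ) : Polynomial ℤ :=
  ∑ k ∈ Finset.range m, C ((cyclotomic (m * p) ℤ).coeff (i * p + k)) * X ^ k


lemma phi_mul (q : ℕ) (hq : q.Prime) (h3 : 3 < q) :
    cyclotomic (3 * q) ℤ * (1 + X + X ^ 2) = 1 + X ^ q + X ^ (2 * q) := by
  have hnd : ¬ q ∣ 3 := fun h => by have := Nat.le_of_dvd (by norm_num) h; omega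
  have := cyclotomic_expand_eq_cyclotomic_mul hq hnd ℤ
  rw [cyclotomic_three] at this
  rw [show (1 + X + X ^ 2 : ℤ[X]) = X ^ 2 + X + 1 by ring, ← this]
  simp [← pow_mul]
  ring

/-- The initial coefficients of `Φ_{3q}`. -/
lemma phi_coeff (q : ℕ) (hq : q.Prime) (h3 : 3 < q) (j : ℕ) (hj : j < q) :
    (cyclotomic (3 * q) ℤ).coeff j = if j % 3 = 0 then 1 else if j % 3 = 1 then -1 else 0 := by
  induction j using Nat.strong_induction_on with
  | _ j ih =>
    have h := congrArg (fun f => coeff f j) (phi_mul q hq h3)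
    simp only [mul_add, mul_one, coeff_add, coeff_mul_X_pow', coeff_X_pow, coeff_one] at h
    rw [if_neg (show ¬ j = q by omega), if_neg (show ¬ j = 2 * q by omega)] at h
    rcases j with _ | _ | j
    · simpa using h
    · have h0 := ih 0 (by omega) (by omega)
      simp at h h0 ⊢
      omega
    · have h0 := ih j (by omega) (by omega)
      have h1 := ih (j+1) (by omega) (by omega)
      simp only [coeff_mul_X] at h
      simp at h
      rw [h0, h1] at h
      split_ifs at h ⊢ <;> omega

/-- Periodic indicator. -/
def dl (q : ℕ) (n : ℤ) : ℤ := if (3 * q : ℤ) ∣ n then 1 else 0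

def uu (q : ℕ) (n : ℤ) : ℤ :=
  dl q n + dl q (n-1) + dl q (n-2) - dl q (n-q) - dl q (n-q-1) - dl q (n-q-2)

lemma dl_per (q : ℕ) (n z : ℤ) : dl q (n + 3 * q * z) = dl q n := by
  unfold dl
  simp only [Int.dvd_add_left (Dvd.intro z rfl)]

lemma uu_per (q : ℕ) (n z : ℤ) : uu q (n + 3 * q * z) = uu q n := by
  unfold uu
  rw [← dl_per q n z, ← dl_per q (n-1) z, ← dl_per q (n-2) z, ← dl_per q (n-q) z,
    ← dl_per q (n-q-1) z, ← dl_per q (n-q-2) z]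
  ring_nf

lemma dl_zero (q : ℕ) (n : ℤ) (h : n < 0) (h' : -(3 * q : ℤ) < n) : dl q n = 0 := by
  unfold dl
  rw [if_neg]
  intro hd
  have := Int.le_of_dvd (by omega : 0 < -n) (by simpa using hd)
  omega

lemma shift_coeff (q d n : ℕ) (hd : d < 3 * q) :
    PowerSeries.coeff n ((PowerSeries.X : PowerSeries ℤ) ^ d *
      PowerSeries.mk (fun n : ℕ => dl q n)) = dl q (n - d) := by
  rw [PowerSeries.coeff_X_pow_mul']
  split_ifs with h
  · simp [Nat.cast_sub h]
  · rw [dl_zero] <;> omega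

lemma V_mul (q : ℕ) (hq : 0 < q) :
    (1 - (PowerSeries.X : PowerSeries ℤ) ^ (3 * q)) * PowerSeries.mk (fun n : ℕ => dl q n) = 1 := by
  ext n
  rw [sub_mul, one_mul, map_sub, PowerSeries.coeff_X_pow_mul', PowerSeries.coeff_one]
  simp only [PowerSeries.coeff_mk]
  split_ifs with h h2 h2
  · omega
  · have := dl_per q ((n - 3 * q : ℕ) : ℤ) 1
    rw [← this, Nat.cast_sub h]; push_cast; ring_nf
  · subst h2; simp [dl]
  · have : dl q n = 0 := by
      unfold dl
      rw [if_neg]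
      intro hd
      have := Int.le_of_dvd (by omega) hd
      omega
    simp [this]

lemma V_inv (q : ℕ) (hq : q.Prime) (h3 : 3 < q) :
    ((cyclotomic (3 * q) ℤ : ℤ[X]) : PowerSeries ℤ) *
      PowerSeries.mk (fun n : ℕ => uu q n) = 1 := by
  have h1 : PowerSeries.mk (fun n : ℕ => uu q n) =
     (1 + PowerSeries.X + PowerSeries.X ^ 2) * (1 - PowerSeries.X ^ q) *
       PowerSeries.mk (fun n : ℕ => dl q n) := by
    rw [show (1 + PowerSeries.X + PowerSeries.X ^ 2 : PowerSeries ℤ) * (1 - PowerSeries.X ^ q) *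
       PowerSeries.mk (fun n : ℕ => dl q n) = 
       (PowerSeries.X ^ 0 * PowerSeries.mk (fun n : ℕ => dl q n)
       + PowerSeries.X ^ 1 * PowerSeries.mk (fun n : ℕ => dl q n)
       + PowerSeries.X ^ 2 * PowerSeries.mk (fun n : ℕ => dl q n)
       - PowerSeries.X ^ q * PowerSeries.mk (fun n : ℕ => dl q n)
       - PowerSeries.X ^ (q + 1) * PowerSeries.mk (fun n : ℕ => dl q n)
       - PowerSeries.X ^ (q + 2) * PowerSeries.mk (fun n : ℕ => dl q n)) by ring]
    ext n
    simp only [map_add, map_sub]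
    rw [shift_coeff _ _ _ (by omega), shift_coeff _ _ _ (by omega), shift_coeff _ _ _ (by omega),
      shift_coeff _ _ _ (by omega), shift_coeff _ _ _ (by omega), shift_coeff _ _ _ (by omega)]
    simp [uu, sub_sub]
  have h2 := congrArg (fun f : ℤ[X] => (f : PowerSeries ℤ)) (phi_mul q hq h3)
  simp only [coe_mul, coe_add, coe_one, coe_pow, coe_X] at h2
  rw [h1, ← mul_assoc, ← mul_assoc, h2]
  refine Eq.trans ?_ (V_mul q hq.pos)
  ring

lemma block_coeff (q p : ℕ) (hq : q.Prime) (h3 : 3 < q) (hp : p.Prime) (hgt : 3 * q < p)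
    (k : ℕ) (hk : k < p) :
    (cyclotomic (3 * q * p) ℤ).coeff ((q - 1) * p + k) =
      ∑ j ∈ Finset.range q, (cyclotomic (3 * q) ℤ).coeff j * uu q ((q - 1 - j) * p + k) := by
  have hnd : ¬ p ∣ 3 * q := fun h => by have := Nat.le_of_dvd (by omega) h; omega
  have he := cyclotomic_expand_eq_cyclotomic_mul hp hnd ℤ
  set Φ := cyclotomic (3 * q) ℤ with hΦ
  have hdeg : Φ.natDegree < 2 * q := by
    rw [hΦ, natDegree_cyclotomic, Nat.totient_mul, Nat.totient_prime hq,
      Nat.totient_prime Nat.prime_three]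
    · omega
    · exact (Nat.coprime_primes Nat.prime_three hq).2 (by omega)
  have h1 : ((cyclotomic (3 * q * p) ℤ : ℤ[X]) : PowerSeries ℤ) =
      ∑ j ∈ Finset.range (2 * q), PowerSeries.C (Φ.coeff j) * (PowerSeries.X ^ (j * p) *
        PowerSeries.mk (fun n : ℕ => uu q n)) := by
    calc _ = ((cyclotomic (3 * q * p) ℤ : ℤ[X]) : PowerSeries ℤ) * ((Φ : PowerSeries ℤ) *
             PowerSeries.mk (fun n : ℕ => uu q n)) := by rw [V_inv q hq h3, mul_one]
      _ = ((expand ℤ p Φ : ℤ[X]) : PowerSeries ℤ) * PowerSeries.mk (fun n : ℕ => uu q n) := by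
          rw [he, coe_mul, mul_assoc (cyclotomic (3 * q * p) ℤ : PowerSeries ℤ)]
      _ = _ := by
          conv_lhs => rw [as_sum_range_C_mul_X_pow' Φ hdeg]
          rw [map_sum, ← coeToPowerSeries.ringHom_apply, map_sum, Finset.sum_mul]
          refine Finset.sum_congr rfl fun j _ => ?_
          simp only [map_mul, expand_C, map_pow, expand_X, coeToPowerSeries.ringHom_apply,
            coe_C, coe_X, ← pow_mul, mul_assoc, mul_comm p j]
  rw [← Polynomial.coeff_coe, h1, map_sum]
  simp only [PowerSeries.coeff_C_mul, PowerSeries.coeff_X_pow_mul', PowerSeries.coeff_mk]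
  symm
  rw [← Finset.sum_subset (Finset.range_subset_range.2 (show q ≤ 2 * q by omega))]
  · refine Finset.sum_congr rfl fun j hj => ?_
    have hj := Finset.mem_range.1 hj
    have hle : j * p ≤ (q - 1) * p := Nat.mul_le_mul_right _ (by omega)
    rw [if_pos (by omega), Nat.cast_sub (by omega)]
    push_cast [Nat.cast_sub (show 1 ≤ q by omega)]
    congr 2; ring
  · intro j _ hj
    have hj : q ≤ j := by simpa using hj
    have hle : (q - 1 + 1) * p ≤ j * p := Nat.mul_le_mul_right _ (by omega)
    rw [add_mul] at hle
    rw [if_neg (by omega), mul_zero]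

/-- Coefficient pattern. -/
def ac (j : ℕ) : ℤ := if j % 3 = 0 then 1 else if j % 3 = 1 then -1 else 0

def DD (q M : ℕ) (K : ℤ) : ℤ := ∑ s ∈ Finset.range M, (-1) ^ s * dl q (K - 3 * s)

def gg (L : ℤ) : ℤ := if L % 6 = 0 then 1 else if L % 6 = 3 then -1 else 0

lemma tri (q t : ℕ) (K : ℤ) : ∑ j ∈ Finset.range (3 * t), ac j * uu q (K - 2 * j) =
    DD q (2 * t) K + DD q (2 * t) (K - 1) - DD q (2 * t) (K - q) - DD q (2 * t) (K - q - 1) := by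
  induction t with
  | zero => simp [DD]
  | succ t ih =>
    have h0 : ac (3 * t) = 1 := by simp [ac]
    have h1 : ac (3 * t + 1) = -1 := by simp [ac, Nat.add_mod]
    have h2 : ac (3 * t + 2) = 0 := by simp [ac, Nat.add_mod]
    have hD : ∀ L, DD q (2 * (t + 1)) L = DD q (2 * t) L + dl q (L - 6 * t) - dl q (L - 6 * t - 3) := by
      intro L
      unfold DD
      rw [show 2 * (t + 1) = 2 * t + 1 + 1 by ring, Finset.sum_range_succ, Finset.sum_range_succ]
      rw [pow_succ, pow_mul]
      push_cast
      ring_nf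
    rw [show 3 * (t + 1) = 3 * t + 1 + 1 + 1 by ring, Finset.sum_range_succ, Finset.sum_range_succ,
      Finset.sum_range_succ, ih, h0, h1, h2, hD, hD, hD, hD]
    unfold uu
    push_cast
    ring_nf

lemma dl_small (q : ℕ) (n : ℤ) (h : n < 3 * q) (h' : -(3 * q : ℤ) < n) :
    dl q n = if n = 0 then 1 else 0 := by
  rcases lt_trichotomy n 0 with h1 | h1 | h1
  · rw [dl_zero q n h1 h', if_neg (by omega)]
  · subst h1; simp [dl]
  · unfold dl
    rw [if_neg, if_neg (by omega)]
    intro hd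
    have := Int.le_of_dvd h1 hd
    omega

lemma DD_small (q M : ℕ) (hM : M ≤ q) (L : ℤ) (h0 : 0 ≤ L) (h1 : L < 3 * q) :
    DD q M L = if L < 3 * M then gg L else 0 := by
  induction M with
  | zero => rw [if_neg (by push_cast; omega)]; simp [DD]
  | succ M ih =>
    have ih := ih (by omega)
    unfold DD at ih ⊢
    rw [Finset.sum_range_succ, ih, dl_small _ _ (by omega) (by omega)]
    push_cast
    by_cases hL : L - 3 * M = 0
    · rw [if_neg (by omega), if_pos hL, if_pos (by omega)]
      unfold gg
      rcases Nat.even_or_odd' M with ⟨c, rfl | rfl⟩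
      · rw [if_pos (by push_cast at hL; omega)]
        simp
      · rw [if_neg (by push_cast at hL; omega), if_pos (by push_cast at hL; omega)]
        simp [pow_succ]
    · rw [if_neg hL]
      by_cases h2 : L < 3 * M
      · rw [if_pos h2, if_pos (by omega)]; ring
      · rw [if_neg h2]
        by_cases h3 : L < 3 * (M + 1)
        · rw [if_pos h3]
          unfold gg
          rw [if_neg (by omega), if_neg (by omega)]; ring
        · rw [if_neg h3]; ring

lemma DD_per (q M : ℕ) (L : ℤ) : DD q M L = DD q M (L - 3 * q) := by
  unfold DD
  refine Finset.sum_congr rfl fun s _ => ?_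
  rw [← dl_per q (L - 3 * q - 3 * s) 1]
  ring_nf

lemma DD_A (q M : ℕ) (hM : M ≤ q) (L : ℤ) (h0 : 0 ≤ L) (h1 : L < 3 * M) : DD q M L = gg L := by
  rw [DD_small q M hM L h0 (by omega), if_pos h1]

lemma DD_B (q M : ℕ) (hM : M ≤ q) (L : ℤ) (h0 : 3 * M ≤ L) (h1 : L < 3 * q) : DD q M L = 0 := by
  rw [DD_small q M hM L (by omega) (by omega), if_neg (by omega)]

lemma DD_C (q M : ℕ) (hM : M ≤ q) (L : ℤ) (h0 : 3 * q ≤ L) (h1 : L < 3 * q + 3 * M) :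
    DD q M L = gg (L - 3 * q) := by
  rw [DD_per, DD_A q M hM _ (by omega) (by omega)]

lemma DD_E (q M : ℕ) (hM : M ≤ q) (L : ℤ) (h0 : 3 * q + 3 * M ≤ L) (h1 : L < 6 * q) :
    DD q M L = 0 := by
  rw [DD_per, DD_B q M hM _ (by omega) (by omega)]

def cc (q k : ℕ) : ℤ := ∑ j ∈ Finset.range q, ac j * uu q ((2 * q - 2 + k : ℤ) - 2 * j)

lemma block_eq (q p : ℕ) (hq : q.Prime) (h3 : 3 < q) (hp : p.Prime) (hgt : 3 * q < p)
    (hmod : p % (3 * q) = 2) (k : ℕ) (hk : k < p) :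
    (cyclotomic (3 * q * p) ℤ).coeff ((q - 1) * p + k) = cc q k := by
  rw [block_coeff q p hq h3 hp hgt k hk]
  unfold cc
  refine Finset.sum_congr rfl fun j hj => ?_
  rw [phi_coeff q hq h3 j (Finset.mem_range.1 hj)]
  have hz : (p : ℤ) = 2 + 3 * q * (p / (3 * q) : ℕ) := by
    have := Nat.mod_add_div p (3 * q)
    rw [hmod] at this
    exact_mod_cast this.symm
  rw [← uu_per q ((2 * q - 2 + k : ℤ) - 2 * j) ((q - 1 - j) * (p / (3 * q) : ℕ))]
  unfold ac
  congr 2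
  generalize ((p / (3 * q) : ℕ) : ℤ) = z at hz ⊢
  rw [hz]; ring

lemma cc1 (t k : ℕ) : cc (3 * t + 1) k =
    DD (3 * t + 1) (2 * t) (6 * t + k) + DD (3 * t + 1) (2 * t) (6 * t + k - 1)
    - DD (3 * t + 1) (2 * t) (3 * t + k - 1) - DD (3 * t + 1) (2 * t) (3 * t + k - 2)
    + uu (3 * t + 1) k := by
  unfold cc
  rw [Finset.sum_range_succ, tri]
  have h0 : ac (3 * t) = 1 := by simp [ac]
  rw [h0]; push_cast; ring_nf

lemma cc2 (t k : ℕ) : cc (3 * t + 2) k =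
    DD (3 * t + 2) (2 * t + 2) (6 * t + 2 + k) + DD (3 * t + 2) (2 * t + 2) (6 * t + 1 + k)
    - DD (3 * t + 2) (2 * t + 2) (3 * t + k) - DD (3 * t + 2) (2 * t + 2) (3 * t + k - 1) := by
  have h2 : ac (3 * t + 2) = 0 := by simp [ac, Nat.add_mod]
  have := tri (3 * t + 2) (t + 1) ((2 * (3 * t + 2 : ℕ) - 2 + k : ℤ))
  rw [show 3 * (t + 1) = 3 * t + 2 + 1 by ring, Finset.sum_range_succ, h2, zero_mul, add_zero] at this
  unfold cc
  rw [this]; push_cast; ring_nf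

lemma hw_count (q p : ℕ) (hq : q.Prime) (h3 : 3 < q) (hp : p.Prime) (hgt : 3 * q < p)
    (hmod : p % (3 * q) = 2) :
    hw (blockPoly (3 * q) p (q - 1)) = Nat.count (fun k => cc q k ≠ 0) (3 * q) := by
  rw [Nat.count_eq_card_filter_range]
  unfold hw blockPoly
  congr 1
  ext k
  simp only [mem_support_iff, finsetSum_coeff, coeff_C_mul, coeff_X_pow, mul_ite, mul_one,
    mul_zero, Finset.sum_ite_eq, Finset.mem_filter, Finset.mem_range]
  by_cases hk : k < 3 * q
  · rw [if_pos hk, block_eq q p hq h3 hp hgt hmod k (by omega)]; tauto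
  · rw [if_neg hk]; tauto

lemma count3 (r n : ℕ) (hr : r < 3) : Nat.count (fun i => i % 3 ≠ r) n =
    n - (n + 2 - r) / 3 := by
  induction n with
  | zero => simp; 
  | succ n ih =>
    rw [Nat.count_succ, ih]
    split_ifs <;> omega

lemma count_congr' (P Q : ℕ → Prop) [DecidablePred P] [DecidablePred Q] (n : ℕ)
    (h : ∀ i < n, (P i ↔ Q i)) : Nat.count P n = Nat.count Q n := by
  rw [Nat.count_eq_card_filter_range, Nat.count_eq_card_filter_range]
  congr 1
  apply Finset.filter_congr
  intro i hi
  exact h i (Finset.mem_range.1 hi)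

lemma DD_all (q M : ℕ) (hM : M ≤ q) (L : ℤ) (h0 : 0 ≤ L) (h1 : L < 6 * q) :
    (L < 3 * M ∧ DD q M L = gg L) ∨ (3 * M ≤ L ∧ L < 3 * q ∧ DD q M L = 0) ∨
    (3 * q ≤ L ∧ L < 3 * q + 3 * M ∧ DD q M L = gg (L - 3 * q)) ∨
    (3 * q + 3 * M ≤ L ∧ DD q M L = 0) := by
  rcases lt_or_ge L (3 * M) with h | h
  · exact Or.inl ⟨h, DD_A q M hM L h0 h⟩
  rcases lt_or_ge L (3 * q) with h2 | h2
  · exact Or.inr (Or.inl ⟨h, h2, DD_B q M hM L h h2⟩)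
  rcases lt_or_ge L (3 * q + 3 * M) with h3 | h3
  · exact Or.inr (Or.inr (Or.inl ⟨h2, h3, DD_C q M hM L h2 h3⟩))
  · exact Or.inr (Or.inr (Or.inr ⟨h3, DD_E q M hM L h3 h1⟩))

lemma gg_all (L : ℤ) : (L % 6 = 0 ∧ gg L = 1) ∨ (L % 6 = 3 ∧ gg L = -1) ∨
    (L % 3 ≠ 0 ∧ gg L = 0) := by
  unfold gg
  split_ifs <;> omega

/-- The nonvanishing pattern when `q = 3t+1`. -/
def P1 (t k : ℕ) : Prop :=
  k = 0 ∨ (3 ≤ k ∧ k < 3 * t + 3 ∧ k % 3 ≠ 0) ∨ (3 * t + 4 ≤ k ∧ k < 6 * t + 4 ∧ (k - 3 * t - 3) % 3 ≠ 2)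
    ∨ (6 * t + 4 ≤ k ∧ (k - 6 * t - 4) % 3 ≠ 0)

set_option maxHeartbeats 4000000 in
lemma pat1 (τ k : ℕ) (hτ : 0 < τ) (hk : k < 3 * (6 * τ + 1)) :
    cc (3 * (2 * τ) + 1) k ≠ 0 ↔ P1 (2 * τ) k := by
  rw [cc1]
  have hu : uu (3 * (2 * τ) + 1) k = if k ≤ 2 then 1 else
      if 6 * τ + 1 ≤ k ∧ k ≤ 6 * τ + 3 then -1 else 0 := by
    unfold uu
    rw [dl_small, dl_small, dl_small, dl_small, dl_small, dl_small] <;> try (push_cast; omega)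
  rw [hu]
  push_cast
  have e1 := DD_all (3 * (2 * τ) + 1) (2 * (2 * τ)) (by omega) (6 * (2 * τ) + k) (by omega) (by push_cast; omega)
  have e2 := DD_all (3 * (2 * τ) + 1) (2 * (2 * τ)) (by omega) (6 * (2 * τ) + k - 1) (by omega) (by push_cast; omega)
  have e3 := DD_all (3 * (2 * τ) + 1) (2 * (2 * τ)) (by omega) (3 * (2 * τ) + k - 1) (by omega) (by push_cast; omega)
  have e4 := DD_all (3 * (2 * τ) + 1) (2 * (2 * τ)) (by omega) (3 * (2 * τ) + k - 2) (by omega) (by push_cast; omega)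
  push_cast at e1 e2 e3 e4
  generalize DD _ _ _ = d1 at *
  generalize DD _ _ _ = d2 at *
  generalize DD _ _ _ = d3 at *
  generalize DD _ _ _ = d4 at *
  unfold P1
  rcases e1 with ⟨a1, b1⟩ | ⟨a1, a1', b1⟩ | ⟨a1, a1', b1⟩ | ⟨a1, b1⟩ <;>
  rcases e2 with ⟨a2, b2⟩ | ⟨a2, a2', b2⟩ | ⟨a2, a2', b2⟩ | ⟨a2, b2⟩ <;> (try omega) <;>
  rcases e3 with ⟨a3, b3⟩ | ⟨a3, a3', b3⟩ | ⟨a3, a3', b3⟩ | ⟨a3, b3⟩ <;> (try omega) <;>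
  rcases e4 with ⟨a4, b4⟩ | ⟨a4, a4', b4⟩ | ⟨a4, a4', b4⟩ | ⟨a4, b4⟩ <;> (try omega) <;>
  rw [b1, b2, b3, b4] <;> clear b1 b2 b3 b4 <;>
  unfold gg <;> split_ifs <;> omega

/-- The nonvanishing pattern when `q = 3t+2`. -/
def P2 (t k : ℕ) : Prop :=
  k = 0 ∨ k = 2 ∨ (3 ≤ k ∧ k < 3 * t + 4 ∧ (k - 3) % 3 ≠ 2) ∨
    (3 * t + 4 ≤ k ∧ k < 6 * t + 6 ∧ (k - 3 * t - 4) % 3 ≠ 2) ∨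
    (6 * t + 6 ≤ k ∧ (k - 6 * t - 6) % 3 ≠ 1)

set_option maxHeartbeats 4000000 in
lemma pat2 (τ k : ℕ) (hk : k < 3 * (6 * τ + 5)) :
    cc (3 * (2 * τ + 1) + 2) k ≠ 0 ↔ P2 (2 * τ + 1) k := by
  rw [cc2]
  have e1 := DD_all (3 * (2 * τ + 1) + 2) (2 * (2 * τ + 1) + 2) (by omega)
    (6 * (2 * τ + 1) + 2 + k) (by omega) (by push_cast; omega)
  have e2 := DD_all (3 * (2 * τ + 1) + 2) (2 * (2 * τ + 1) + 2) (by omega)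
    (6 * (2 * τ + 1) + 1 + k) (by omega) (by push_cast; omega)
  have e3 := DD_all (3 * (2 * τ + 1) + 2) (2 * (2 * τ + 1) + 2) (by omega)
    (3 * (2 * τ + 1) + k) (by omega) (by push_cast; omega)
  have e4 := DD_all (3 * (2 * τ + 1) + 2) (2 * (2 * τ + 1) + 2) (by omega)
    (3 * (2 * τ + 1) + k - 1) (by omega) (by push_cast; omega)
  push_cast at e1 e2 e3 e4 ⊢
  generalize DD _ _ _ = d1 at *
  generalize DD _ _ _ = d2 at *
  generalize DD _ _ _ = d3 at *
  generalize DD _ _ _ = d4 at *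
  unfold P2
  rcases e1 with ⟨a1, b1⟩ | ⟨a1, a1', b1⟩ | ⟨a1, a1', b1⟩ | ⟨a1, b1⟩ <;>
  rcases e2 with ⟨a2, b2⟩ | ⟨a2, a2', b2⟩ | ⟨a2, a2', b2⟩ | ⟨a2, b2⟩ <;> (try omega) <;>
  rcases e3 with ⟨a3, b3⟩ | ⟨a3, a3', b3⟩ | ⟨a3, a3', b3⟩ | ⟨a3, b3⟩ <;> (try omega) <;>
  rcases e4 with ⟨a4, b4⟩ | ⟨a4, a4', b4⟩ | ⟨a4, a4', b4⟩ | ⟨a4, b4⟩ <;> (try omega) <;>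
  rw [b1, b2, b3, b4] <;> clear b1 b2 b3 b4 <;>
  unfold gg <;> split_ifs <;> omega

lemma count_step (P Q : ℕ → Prop) [DecidablePred P] [DecidablePred Q] (a b : ℕ)
    (h : ∀ i < a, (P i ↔ Q i)) :
    Nat.count P (a + b) = Nat.count Q a + Nat.count (fun k => P (a + k)) b := by
  rw [Nat.count_add, count_congr' P Q a h]

lemma cnt1 (τ : ℕ) (hτ : 0 < τ) :
    Nat.count (fun k => cc (3 * (2 * τ) + 1) k ≠ 0) (3 * (3 * (2 * τ) + 1)) = 12 * τ := by
  rw [show 3 * (3 * (2 * τ) + 1) = 1 + (2 + (6 * τ + (1 + (6 * τ + (6 * τ - 1))))) by omega,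
    count_step _ (fun _ => True) 1, count_step _ (fun _ => False) 2,
    count_step _ (fun i => i % 3 ≠ 0) (6 * τ), count_step _ (fun _ => False) 1,
    count_step _ (fun i => i % 3 ≠ 1) (6 * τ), count_congr' _ (fun i => i % 3 ≠ 0) (6 * τ - 1),
    count3 0 _ (by omega), count3 1 _ (by omega), count3 0 _ (by omega),
    Nat.count_true, Nat.count_false, Nat.count_false]
  all_goals try omega
  all_goals
    intro i hi
    rw [pat1 τ _ hτ (by omega)]
    unfold P1
    first | omega | (simp only [iff_true, iff_false]; omega)

lemma cnt2 (τ : ℕ) :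
    Nat.count (fun k => cc (3 * (2 * τ + 1) + 2) k ≠ 0) (3 * (3 * (2 * τ + 1) + 2)) =
      12 * τ + 11 := by
  rw [show 3 * (3 * (2 * τ + 1) + 2) = 1 + (1 + (1 + ((6 * τ + 4) + ((6 * τ + 5) + (6 * τ + 3)))))
      by omega,
    count_step _ (fun _ => True) 1, count_step _ (fun _ => False) 1, count_step _ (fun _ => True) 1,
    count_step _ (fun i => i % 3 ≠ 2) (6 * τ + 4),
    count_step _ (fun i => i % 3 ≠ 2) (6 * τ + 5), count_congr' _ (fun i => i % 3 ≠ 1) (6 * τ + 3),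
    count3 2 _ (by omega), count3 2 _ (by omega), count3 1 _ (by omega),
    Nat.count_true, Nat.count_false]
  all_goals try omega
  all_goals
    intro i hi
    rw [pat2 τ _ (by omega)]
    unfold P2
    first | omega | (simp only [iff_true, iff_false]; omega)

theorem stmt15 (p₂ p₃ : ℕ) (hp₂ : p₂.Prime) (h3 : 3 < p₂)
    (hp₃ : p₃.Prime) (hgt : 3 * p₂ < p₃) (hmod : p₃ % (3 * p₂) = 2) :
    (p₂ % 3 = 1 → hw (blockPoly (3 * p₂) p₃ (p₂ - 1)) = 2 * (p₂ - 1)) ∧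
    (p₂ % 3 = 2 → hw (blockPoly (3 * p₂) p₃ (p₂ - 1)) = 2 * p₂ + 1) := by
  rw [hw_count p₂ p₃ hp₂ h3 hp₃ hgt hmod]
  have hodd : p₂ % 2 = 1 := hp₂.eq_two_or_odd.resolve_left (by omega)
  constructor
  · intro h
    obtain ⟨τ, rfl⟩ : ∃ τ, p₂ = 3 * (2 * τ) + 1 := ⟨p₂ / 6, by omega⟩
    rw [cnt1 τ (by omega)]
    omega
  · intro h
    obtain ⟨τ, rfl⟩ : ∃ τ, p₂ = 3 * (2 * τ + 1) + 2 := ⟨p₂ / 6, by omega⟩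
    rw [cnt2 τ]
    omega
end
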